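/- arXiv:1203.4047 — 2 statements merged into one kernel-verified Lean document; each statement's English description precedes it below -/
import Mathlib

section
/- Let p be a prime, q = p^ν a power of p, n ≥ 1, and let k be the algebraic closure of the field 𝔽_{q²}. Then the map λ : GL_{n+1}(k) → GL_{n+1}(k) defined by λ(T) = T · (conj T)ᵀ, where conj T is the matrix obtained from T by raising every entry to the q-th power, is surjective. -/
open Polynomial in
/-- Auxiliary additive polynomials. -/
noncomputable def auxP {k : Type*} [Field k] (Q : ℕ) (a : ℕ → k) : ℕ → k[X]
  | 0 => C (a 0) * X ^ Q
  | i + 1 => (auxP Q a i) ^ Q + C (a (i + 1)) * X ^ Q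

open Polynomial in
theorem auxP_dvd {k : Type*} [Field k] (Q : ℕ) (hQ : 2 ≤ Q) (a : ℕ → k) (i : ℕ) :
    (X : k[X]) ^ 2 ∣ auxP Q a i := by
  have hX : (X : k[X]) ^ 2 ∣ X ^ Q := pow_dvd_pow _ hQ
  induction i with
  | zero => exact Dvd.dvd.mul_left hX _
  | succ i ih =>
    exact dvd_add (dvd_pow ih (by omega)) (Dvd.dvd.mul_left hX _)

open Polynomial in
theorem auxP_ne {k : Type*} [Field k] (Q : ℕ) (hQ : 2 ≤ Q) (a : ℕ → k) (i : ℕ)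
    (h : ∃ j ≤ i, a j ≠ 0) : auxP Q a i ≠ 0 := by
  induction i with
  | zero =>
    obtain ⟨j, hj, hne⟩ := h
    obtain rfl : j = 0 := by omega
    simp [auxP, hne]
  | succ i ih =>
    by_cases ha : a (i + 1) = 0
    · obtain ⟨j, hj, hne⟩ := h
      have hj' : j ≤ i := by
        rcases Nat.lt_or_ge i j with h1 | h1
        · obtain rfl : j = i + 1 := by omega
          exact absurd ha hne
        · exact h1
      have := ih ⟨j, hj', hne⟩
      simp [auxP, ha, this]
    · intro h0
      have h1 := congrArg (fun f => coeff f Q) h0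
      have h2 : (X : k[X]) ^ (2 * Q) ∣ (auxP Q a i) ^ Q := by
        rw [pow_mul]; exact pow_dvd_pow_of_dvd (auxP_dvd Q hQ a i) Q
      have h3 := (X_pow_dvd_iff.1 h2) Q (by omega)
      simp [auxP, h3] at h1
      exact ha h1

open Polynomial in
theorem auxP_root {k : Type*} [Field k] [IsAlgClosed k] (Q : ℕ) (hQ : 2 ≤ Q) (a : ℕ → k) (i : ℕ)
    (h : ∃ j ≤ i, a j ≠ 0) : ∃ t : k, t ≠ 0 ∧ (auxP Q a i).eval t = t := by
  obtain ⟨R, hR⟩ := auxP_dvd Q hQ a i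
  have hR0 : R ≠ 0 := by
    rintro rfl
    exact auxP_ne Q hQ a i h (by simpa using hR)
  have hd : (X * R - C 1).degree ≠ 0 := by
    have : (X * R).degree = R.degree + 1 := by rw [mul_comm, degree_mul, degree_X]
    have h1 : (0 : WithBot ℕ) < (X * R).degree := by
      rw [this, degree_eq_natDegree hR0]
      exact_mod_cast Nat.succ_pos _
    rw [degree_sub_C h1]
    exact h1.ne'
  obtain ⟨t, ht⟩ := IsAlgClosed.exists_root _ hd
  have ht' : t * R.eval t = 1 := by
    simpa [IsRoot, sub_eq_zero] using ht
  refine ⟨t, ?_, ?_⟩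
  · rintro rfl
    simp at ht'
  · rw [hR, eval_mul, eval_pow, eval_X, sq, mul_assoc, ht', mul_one]

theorem iter_li {k V : Type*} [Field k] [AddCommGroup V] [Module k V] (w : ℕ → V) (m : ℕ)
    (h : ∀ j < m, w j ∉ Submodule.span k (Set.range fun i : Fin j => w i)) :
    LinearIndependent k (fun i : Fin m => w i) := by
  induction m with
  | zero => exact linearIndependent_empty_type
  | succ m ih =>
    rw [linearIndependent_finSucc']
    refine ⟨ih fun j hj => h j (by omega), ?_⟩
    exact h m (by omega)

theorem exists_fixed {k V : Type*} [Field k] [IsAlgClosed k] [AddCommGroup V] [Module k V]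
    [FiniteDimensional k V] [Nontrivial V] (τ : k →+* k) (Q : ℕ) (hQ : 2 ≤ Q)
    (hτ : ∀ x, τ x = x ^ Q) (f : V →ₛₗ[τ] V) (hf : Function.Injective f) :
    ∃ v, v ≠ 0 ∧ f v = v := by
  classical
  obtain ⟨v, hv⟩ := exists_ne (0 : V)
  let w : ℕ → V := fun i => f^[i] v
  have hws : ∀ i, f (w i) = w (i + 1) := fun i => (Function.iterate_succ_apply' f i v).symm
  have hw0 : ∀ i, w i ≠ 0 := by
    intro i
    induction i with
    | zero => exact hv
    | succ i ih =>
      rw [← hws]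
      intro h
      exact ih (hf (by rw [h, map_zero]))
  have hex : ∃ m, w m ∈ Submodule.span k (Set.range fun i : Fin m => w i) := by
    by_contra! hcon
    have := (iter_li (k := k) w (Module.finrank k V + 1) fun j _ => hcon j).fintype_card_le_finrank
    simp at this
  have hm := Nat.find_spec hex
  have hmin : ∀ j < Nat.find hex, w j ∉ Submodule.span k (Set.range fun i : Fin j => w i) :=
    fun j hj => Nat.find_min hex hj
  generalize Nat.find hex = m at hm hmin
  have hli := iter_li (k := k) w m hmin
  obtain _ | M := m
  · simp at hm
    exact absurd hm (hw0 0)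
  obtain ⟨b, hb⟩ := (Submodule.mem_span_range_iff_exists_fun k).1 hm
  let a : ℕ → k := fun i => if h : i < M + 1 then b ⟨i, h⟩ else 0
  have ha : ∑ i ∈ Finset.range (M + 1), a i • w i = w (M + 1) := by
    rw [← hb, Finset.sum_range]
    refine Finset.sum_congr rfl fun i _ => ?_
    have hi := i.2
    simp only [a, dif_pos hi]
  have hane : ∃ j ≤ M, a j ≠ 0 := by
    by_contra! hcon
    apply hw0 (M + 1)
    rw [← ha]
    refine Finset.sum_eq_zero fun i hi => ?_
    rw [hcon i (by simpa [Nat.lt_succ_iff] using hi), zero_smul]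
  obtain ⟨t, ht0, ht⟩ := auxP_root Q hQ a M hane
  let x : ℕ → k := fun i => (auxP Q a i).eval t
  have hx0 : x 0 = a 0 * t ^ Q := by simp [x, auxP]
  have hxs : ∀ i, x (i + 1) = x i ^ Q + a (i + 1) * t ^ Q := fun i => by simp [x, auxP]
  have hxM : x M = t := ht
  refine ⟨∑ i ∈ Finset.range (M + 1), x i • w i, ?_, ?_⟩
  · intro h
    rw [Finset.sum_range] at h
    have := Fintype.linearIndependent_iff.1 hli (fun i => x i) h ⟨M, by omega⟩
    exact ht0 (hxM ▸ this)
  · rw [map_sum]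
    simp only [LinearMap.map_smulₛₗ, hτ, hws]
    rw [Finset.sum_range_succ, hxM, ← ha, Finset.sum_range_succ' _ M, Finset.sum_range_succ' _ M,
      hx0, smul_add, Finset.smul_sum, ← add_assoc, ← Finset.sum_add_distrib]
    congr 1
    · refine Finset.sum_congr rfl fun i _ => ?_
      rw [hxs, add_smul, smul_smul, mul_comm (t ^ Q)]
    · rw [smul_smul, mul_comm]

open Polynomial in
theorem solve_AS {k : Type*} [Field k] [IsAlgClosed k] (Q : ℕ) (hQ : 2 ≤ Q) (e a : k) :
    ∃ x : k, x ^ Q + e * x = a := by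
  have hd : (X ^ Q + (C e * X - C a) : k[X]).degree = Q := by
    have h1 : (C e * X - C a : k[X]).degree < Q := by
      refine lt_of_le_of_lt ?_ (show ((1 : ℕ) : WithBot ℕ) < Q by exact_mod_cast hQ)
      compute_degree
      all_goals norm_num
    rw [degree_add_eq_left_of_degree_lt] <;> rw [degree_X_pow]
    exact h1
  obtain ⟨x, hx⟩ := IsAlgClosed.exists_root (X ^ Q + (C e * X - C a) : k[X]) (by
    rw [hd]; exact_mod_cast (by omega : Q ≠ 0))
  refine ⟨x, ?_⟩
  simp [IsRoot] at hx
  linear_combination hx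

/-- Lang's theorem, in the form: fixed vectors of an injective Frobenius-semilinear map span. -/
theorem span_fixed {k V : Type*} [Field k] [IsAlgClosed k] [AddCommGroup V] [Module k V]
    [FiniteDimensional k V] (τ : k →+* k) (Q : ℕ) (hQ : 2 ≤ Q)
    (hτ : ∀ x, τ x = x ^ Q) (f : V →ₛₗ[τ] V) (hf : Function.Injective f) :
    Submodule.span k {v | f v = v} = ⊤ := by
  set W := Submodule.span k {v | f v = v} with hW
  -- every element of W is f of an element of W
  have hsurj : ∀ w ∈ W, ∃ u ∈ W, f u = w := by
    intro w hw
    induction hw using Submodule.span_induction with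
    | mem x hx => exact ⟨x, Submodule.subset_span hx, hx⟩
    | zero => exact ⟨0, zero_mem _, map_zero _⟩
    | add x y _ _ hx hy =>
      obtain ⟨u, hu, rfl⟩ := hx
      obtain ⟨v, hv, rfl⟩ := hy
      exact ⟨u + v, add_mem hu hv, map_add _ _ _⟩
    | smul c x _ hx =>
      obtain ⟨u, hu, rfl⟩ := hx
      obtain ⟨d, hd⟩ := IsAlgClosed.exists_pow_nat_eq c (show 0 < Q by omega)
      exact ⟨d • u, W.smul_mem _ hu, by rw [LinearMap.map_smulₛₗ, hτ, hd]⟩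
  have hAS : ∀ w ∈ W, ∃ u ∈ W, f u - u = w := by
    intro w hw
    rw [hW] at hw
    refine Submodule.closure_induction (p := fun w _ => ∃ u ∈ W, f u - u = w) ?_ ?_ ?_ hw
    · exact ⟨0, zero_mem _, by simp⟩
    · rintro x y _ _ ⟨u, hu, rfl⟩ ⟨v, hv, rfl⟩
      exact ⟨u + v, add_mem hu hv, by rw [map_add]; abel⟩
    · intro c x hx
      obtain ⟨d, hd⟩ := solve_AS Q hQ (-1 : k) c
      refine ⟨d • x, W.smul_mem _ (Submodule.subset_span hx), ?_⟩
      rw [LinearMap.map_smulₛₗ, hτ, show f x = x from hx, ← sub_smul,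
        show d ^ Q - d = c by linear_combination hd]
  have hmap : W ≤ W.comap f := by
    rw [hW, Submodule.span_le]
    intro v hv
    have : f v = v := hv
    simp only [Submodule.comap_coe, Set.mem_preimage, this]
    exact Submodule.subset_span hv
  by_contra hne
  have : Nontrivial (V ⧸ W) := Submodule.Quotient.nontrivial_iff.2 hne
  have hinj : Function.Injective (W.mapQ W f hmap) := by
    rw [injective_iff_map_eq_zero]
    intro y hy
    obtain ⟨v, rfl⟩ := W.mkQ_surjective y
    rw [Submodule.mkQ_apply, Submodule.mapQ_apply, Submodule.Quotient.mk_eq_zero] at hy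
    obtain ⟨u, hu, huv⟩ := hsurj _ hy
    rw [← hf huv]
    simpa using hu
  obtain ⟨y, hy0, hy⟩ := exists_fixed τ Q hQ hτ (W.mapQ W f hmap) hinj
  obtain ⟨v, rfl⟩ := W.mkQ_surjective y
  rw [Submodule.mkQ_apply, Submodule.mapQ_apply, Submodule.Quotient.eq] at hy
  obtain ⟨u, hu, huv⟩ := hAS _ hy
  apply hy0
  rw [Submodule.mkQ_apply, Submodule.Quotient.mk_eq_zero]
  have h1 : v - u ∈ W := Submodule.subset_span (by
    show f (v - u) = v - u
    rw [map_sub]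
    rw [sub_eq_sub_iff_sub_eq_sub]
    exact huv.symm)
  simpa using add_mem h1 hu

/-- Extending an orthonormal family of Hermitian vectors. -/
theorem extend_step {k V : Type*} [Field k] [IsAlgClosed k] [AddCommGroup V] [Module k V]
    [FiniteDimensional k V] (σ : k →+* k) (Q : ℕ) (hQ : 2 ≤ Q)
    (hσ : ∀ x, σ x = x ^ Q) (h : V →ₗ[k] V →ₛₗ[σ] k)
    (hnd : ∀ x, (∀ y, h x y = 0) → x = 0)
    (hspan : Submodule.span k {v | ∀ u, σ (h u v) = h v u} = ⊤)
    (m : ℕ) (hm : m < Module.finrank k V) (e : Fin m → V)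
    (heH : ∀ i u, σ (h u (e i)) = h (e i) u)
    (he : ∀ i j, h (e i) (e j) = if i = j then 1 else 0) :
    ∃ w : V, (∀ u, σ (h u w) = h w u) ∧ h w w = 1 ∧ ∀ i, h w (e i) = 0 := by
  classical
  -- Hermitian vectors orthogonal to all `e i`
  let K : Set V := {w | (∀ u, σ (h u w) = h w u) ∧ ∀ i, h w (e i) = 0}
  have hK2 : ∀ u ∈ K, ∀ v ∈ K, σ (σ (h u v)) = h u v := fun u hu v hv => by
    rw [hv.1, hu.1]
  have hKadd : ∀ u ∈ K, ∀ v ∈ K, u + v ∈ K := fun u hu v hv =>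
    ⟨fun x => by simp [hu.1, hv.1], fun i => by simp [hu.2, hv.2]⟩
  have hKsmul : ∀ c : k, σ (σ c) = c → ∀ v ∈ K, c • v ∈ K := fun c hc v hv =>
    ⟨fun x => by simp [hv.1, hc], fun i => by simp [hv.2]⟩
  -- it suffices to find an anisotropic one
  suffices hsuff : ∃ w ∈ K, h w w ≠ 0 by
    obtain ⟨w, hw, hne⟩ := hsuff
    obtain ⟨c, hc⟩ := IsAlgClosed.exists_pow_nat_eq (h w w)⁻¹ (show 0 < Q + 1 by omega)
    have hc1 : σ c * c = (h w w)⁻¹ := by rw [hσ, ← pow_succ, hc]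
    have hc0 : c ≠ 0 := by
      rintro rfl
      rw [mul_zero] at hc1
      exact inv_ne_zero hne hc1.symm
    have hσc0 : σ c ≠ 0 := by simpa using hc0
    have hcc : σ (σ c) = c := by
      have h2 := congrArg σ hc1
      rw [map_mul, map_inv₀, hw.1 w, ← hc1, mul_comm (σ c)] at h2
      exact mul_right_cancel₀ hσc0 h2
    have hcw := hKsmul c hcc w hw
    refine ⟨c • w, hcw.1, ?_, hcw.2⟩
    have : h (c • w) (c • w) = (σ c * c) * h w w := by simp; ring
    rw [this, hc1, inv_mul_cancel₀ hne]
  by_contra! hiso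
  -- polarisation
  have hpol : ∀ u ∈ K, ∀ v ∈ K, h u v = 0 := by
    intro u hu v hv
    by_contra hx
    obtain ⟨z, hz⟩ := solve_AS Q hQ (1 : k) 1
    have hz1 : σ z = 1 - z := by rw [hσ]; linear_combination hz
    have hz2 : σ (σ z) = z := by rw [hz1, map_sub, map_one, hz1]; ring
    have hxx := hK2 u hu v hv
    have hσx : σ (h u v) ≠ 0 := by simpa using hx
    let c := σ z / σ (h u v)
    have hc : σ c = z / h u v := by simp only [c, map_div₀, hz2, hxx]
    have hcc : σ (σ c) = c := by rw [hc, map_div₀]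
    have := hiso _ (hKadd u hu _ (hKsmul c hcc v hv))
    simp only [map_add, LinearMap.add_apply, map_smul, LinearMap.smul_apply,
      LinearMap.map_smulₛₗ, hiso u hu, hiso v hv, smul_eq_mul, ← hv.1 u, hc] at this
    simp only [c] at this
    rw [mul_zero, add_zero, div_mul_cancel₀ _ hx, div_mul_cancel₀ _ hσx, hz1] at this
    simp at this
  -- the projection
  let P : V →ₗ[k] V := LinearMap.id - ∑ i, (h.flip (e i)).smulRight (e i)
  have hP : ∀ v, P v = v - ∑ i, h v (e i) • e i := fun v => by
    simp [P, LinearMap.sum_apply]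
  have hPe : ∀ v i, h (P v) (e i) = 0 := fun v i => by
    simp [hP, LinearMap.sum_apply, he]
  have hPK : ∀ v, (∀ u, σ (h u v) = h v u) → P v ∈ K := by
    intro v hv
    refine ⟨fun u => ?_, hPe v⟩
    simp [hP, LinearMap.sum_apply, hv, heH]
  have hzero : ∀ u v, h (P u) (P v) = 0 := by
    intro u v
    have hu : u ∈ Submodule.span k {v | ∀ u, σ (h u v) = h v u} := hspan ▸ Submodule.mem_top
    have hv : v ∈ Submodule.span k {v | ∀ u, σ (h u v) = h v u} := hspan ▸ Submodule.mem_top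
    induction hu using Submodule.span_induction with
    | zero => simp
    | add x y _ _ hx hy => simp [hx, hy]
    | smul c x _ hx => simp [hx]
    | mem u hu =>
      induction hv using Submodule.span_induction with
      | zero => simp
      | add x y _ _ hx hy => simp [hx, hy]
      | smul c x _ hx => simp [hx]
      | mem v hv => exact hpol _ (hPK u hu) _ (hPK v hv)
  have hP0 : ∀ u, P u = 0 := by
    intro u
    apply hnd
    intro v
    have h1 := hzero u v
    rw [hP v, map_sub, map_sum] at h1
    simpa [hPe] using h1
  have htop : Submodule.span k (Set.range e) = ⊤ := by
    rw [eq_top_iff]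
    intro v _
    have h1 := hP0 v
    rw [hP, sub_eq_zero] at h1
    rw [h1]
    exact Submodule.sum_mem _ fun i _ => Submodule.smul_mem _ _ (Submodule.subset_span ⟨i, rfl⟩)
  have := finrank_range_le_card (R := k) e
  rw [Set.finrank, htop, finrank_top, Fintype.card_fin] at this
  omega

theorem exists_orthonormal {k V : Type*} [Field k] [IsAlgClosed k] [AddCommGroup V] [Module k V]
    [FiniteDimensional k V] (σ : k →+* k) (Q : ℕ) (hQ : 2 ≤ Q)
    (hσ : ∀ x, σ x = x ^ Q) (h : V →ₗ[k] V →ₛₗ[σ] k)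
    (hnd : ∀ x, (∀ y, h x y = 0) → x = 0)
    (hspan : Submodule.span k {v | ∀ u, σ (h u v) = h v u} = ⊤)
    (m : ℕ) (hm : m ≤ Module.finrank k V) : ∃ e : Fin m → V,
    (∀ i u, σ (h u (e i)) = h (e i) u) ∧
    (∀ i j, h (e i) (e j) = if i = j then 1 else 0) := by
  induction m with
  | zero => exact ⟨Fin.elim0, fun i => i.elim0, fun i => i.elim0⟩
  | succ m ih =>
    obtain ⟨e, heH, he⟩ := ih (by omega)
    obtain ⟨w, hwH, hww, hwe⟩ := extend_step σ Q hQ hσ h hnd hspan m (by omega) e heH he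
    have hew : ∀ i, h (e i) w = 0 := fun i => by
      rw [← heH, hwe, map_zero]
    refine ⟨Fin.cons w e, ?_, ?_⟩
    · intro i
      refine Fin.cases ?_ (fun i => ?_) i
      · simpa using hwH
      · simpa using heH i
    · intro i j
      refine Fin.cases ?_ (fun i => ?_) i <;> refine Fin.cases ?_ (fun j => ?_) j
      · simpa using hww
      · simpa [(Fin.succ_ne_zero j).symm] using hwe j
      · simpa using hew i
      · simpa using he i j

open Matrix in
theorem lang_matrix {k : Type*} [Field k] [IsAlgClosed k] (σ : k →+* k) (Q : ℕ) (hQ : 2 ≤ Q)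
    (hσ : ∀ x, σ x = x ^ Q) (N : ℕ) (A : Matrix (Fin N) (Fin N) k) (hA : IsUnit A) :
    ∃ S : Matrix (Fin N) (Fin N) k, S * A * (S.map σ)ᵀ = 1 := by
  classical
  have hdet : IsUnit A.det := (Matrix.isUnit_iff_isUnit_det A).1 hA
  have hdetT : IsUnit Aᵀ.det := by rwa [Matrix.det_transpose]
  let h : (Fin N → k) →ₗ[k] (Fin N → k) →ₛₗ[σ] k :=
    LinearMap.mk₂'ₛₗ (RingHom.id k) σ (fun x y => x ⬝ᵥ (A *ᵥ (σ ∘ y)))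
      (fun x y z => by rw [add_dotProduct])
      (fun c x y => by rw [smul_dotProduct]; rfl)
      (fun x y z => by
        rw [← dotProduct_add, ← mulVec_add]; congr 2; ext i; simp)
      (fun c x y => by
        rw [← dotProduct_smul, ← mulVec_smul]; congr 2; ext i; simp)
  have hh : ∀ x y, h x y = x ⬝ᵥ (A *ᵥ (σ ∘ y)) := fun x y => rfl
  have hQQ : 2 ≤ Q * Q := by nlinarith
  have hτ : ∀ x, (σ.comp σ) x = x ^ (Q * Q) := fun x => by
    rw [RingHom.comp_apply, hσ, hσ, pow_mul]
  let B := (Aᵀ)⁻¹ * A.map σ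
  let f : (Fin N → k) →ₛₗ[σ.comp σ] (Fin N → k) :=
    { toFun := fun v => B *ᵥ (σ ∘ σ ∘ v)
      map_add' := fun x y => by
        rw [← mulVec_add]; congr 1; ext i; simp
      map_smul' := fun c x => by
        rw [← mulVec_smul]; congr 1; ext i; simp }
  have hf' : ∀ v, f v = B *ᵥ (σ ∘ σ ∘ v) := fun v => rfl
  have hAσ : IsUnit (A.map σ) := hA.map σ.mapMatrix
  have hB : IsUnit B :=
    ((Matrix.isUnit_nonsing_inv_iff).2 ((Matrix.isUnit_iff_isUnit_det _).2 hdetT)).mul hAσ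
  have hf : Function.Injective f := by
    intro x y hxy
    have h1 := Matrix.mulVec_injective_of_isUnit hB hxy
    ext i
    exact σ.injective (σ.injective (congrFun h1 i))
  have hsp := span_fixed _ _ hQQ hτ f hf
  have hspan : Submodule.span k {v | ∀ u, σ (h u v) = h v u} = ⊤ := by
    rw [eq_top_iff, ← hsp]
    apply Submodule.span_mono
    intro v hv u
    have hv' : B *ᵥ (σ ∘ σ ∘ v) = v := hv
    have h1 : A.map σ *ᵥ (σ ∘ σ ∘ v) = Aᵀ *ᵥ v := by
      conv_rhs => rw [← hv']
      rw [mulVec_mulVec, Matrix.mul_nonsing_inv_cancel_left _ _ hdetT]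
    have h2 : σ ∘ (A *ᵥ (σ ∘ v)) = A.map σ *ᵥ (σ ∘ σ ∘ v) := by
      ext i
      exact RingHom.map_mulVec σ A (σ ∘ v) i
    rw [hh, hh, RingHom.map_dotProduct, h2, h1, mulVec_transpose,
      dotProduct_comm, dotProduct_mulVec]
  have hnd : ∀ x, (∀ y, h x y = 0) → x = 0 := by
    intro x hx
    have h1 : x ᵥ* A = 0 := by
      ext j
      have := hx (Pi.single j 1)
      rw [hh, dotProduct_mulVec] at this
      have h2 : σ ∘ (Pi.single j 1 : Fin N → k) = Pi.single j 1 := by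
        ext i; by_cases hij : i = j <;> simp [Pi.single_apply, hij]
      rw [h2] at this
      simpa using this
    have := congrArg (fun y => y ᵥ* A⁻¹) h1
    simpa [vecMul_vecMul, Matrix.mul_nonsing_inv _ hdet] using this
  obtain ⟨e, -, he⟩ := exists_orthonormal σ Q hQ hσ h hnd hspan N (by simp)
  refine ⟨Matrix.of e, ?_⟩
  ext i j
  have := he i j
  rw [hh, dotProduct_mulVec] at this
  rw [Matrix.one_apply, ← this]
  rfl

/-- Surjectivity of `λ(T) = T ⬝ (conj T)ᵀ` on `GL_{n+1}(k)`, where `k` is the algebraic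
closure of `𝔽_{q²}` and `conj` raises every entry to the `q`-th power. -/
theorem stmt_0 (p ν n q : ℕ) [Fact p.Prime] (hν : 0 < ν) (hn : 1 ≤ n) (hq : q = p ^ ν)
    (k : Type*) [Field k] [Algebra (GaloisField p (2 * ν)) k]
    [IsAlgClosure (GaloisField p (2 * ν)) k]
    (A : Matrix (Fin (n + 1)) (Fin (n + 1)) k) (hA : IsUnit A) :
    ∃ T : Matrix (Fin (n + 1)) (Fin (n + 1)) k,
      IsUnit T ∧ T * (T.map fun a => a ^ q).transpose = A := by
  have : IsAlgClosed k := IsAlgClosure.isAlgClosed (GaloisField p (2 * ν))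
  have : CharP k p := charP_of_injective_algebraMap
    (algebraMap (GaloisField p (2 * ν)) k).injective p
  have : ExpChar k p := ExpChar.prime Fact.out
  have hQ : 2 ≤ q := by
    have h2 := (Fact.out : p.Prime).two_le
    calc 2 ≤ p := h2
      _ = p ^ 1 := (pow_one p).symm
      _ ≤ q := hq ▸ Nat.pow_le_pow_right (by omega) hν
  let σ : k →+* k := iterateFrobenius k p ν
  have hσ : ∀ x, σ x = x ^ q := fun x => by rw [hq]; exact iterateFrobenius_def p ν x
  have hσ' : (fun a : k => a ^ q) = σ := by ext x; rw [hσ]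
  rw [hσ']
  obtain ⟨S, hS⟩ := lang_matrix σ q hQ hσ (n + 1) A hA
  have hS1 : S * (A * (S.map σ).transpose) = 1 := by rw [← mul_assoc, hS]
  have hS2 : S⁻¹ = A * (S.map σ).transpose := Matrix.inv_eq_right_inv hS1
  have hSS : S * S⁻¹ = 1 := by rw [hS2, hS1]
  have hSS' : S⁻¹ * S = 1 := mul_eq_one_comm.1 hSS
  refine ⟨S⁻¹, .of_mul_eq_one _ hSS', ?_⟩
  have h1 : (S.map σ).transpose * (S⁻¹.map σ).transpose = 1 := by
    rw [← Matrix.transpose_mul, ← Matrix.map_mul, hSS']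
    simp
  nth_rewrite 1 [hS2]
  rw [mul_assoc, h1, mul_one]
end

section
/- Let p be a prime, q = p^ν, and let k be an algebraically closed field of characteristic p containing 𝔽_{q²}. Let n ≥ 2 satisfy n ≢ 0 (mod p) and 2n ≤ q. Suppose A = (a_{ij})_{0 ≤ i,j ≤ n} is a matrix over k and h ∈ k[t] is a polynomial of degree q that is separable (has q distinct roots in k), satisfies h(0) = 0 and h(1) = 0, and is such that Σ_{i,j} a_{ij} t^{i+qj} = h^n in k[t]. Then there exists b ∈ k with b ≠ 0 such that h = b·(t^q − t) and A = b^n · B, where B is the matrix with b_{ij} = (-1)^i · binomial(n, i) if i + j = n and 0 otherwise. -/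
open Polynomial in
/-- Coefficients of the pullback polynomial. -/
theorem aux_coeff {k : Type*} [Field k] (n q : ℕ) (hnq : n < q)
    (A : Matrix (Fin (n + 1)) (Fin (n + 1)) k) (i j : Fin (n + 1)) :
    (∑ i : Fin (n + 1), ∑ j : Fin (n + 1),
      C (A i j) * X ^ ((i : ℕ) + q * (j : ℕ)) : k[X]).coeff ((i : ℕ) + q * (j : ℕ)) = A i j := by
  simp only [finsetSum_coeff, coeff_C_mul, coeff_X_pow]
  rw [Finset.sum_eq_single i, Finset.sum_eq_single j]
  · simp
  · intro b _ hb
    rw [if_neg, mul_zero]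
    intro h
    apply hb
    have h' : q * (j : ℕ) = q * (b : ℕ) := by omega
    exact Fin.ext (Nat.eq_of_mul_eq_mul_left (by omega) h').symm
  · simp
  · intro b _ hb
    apply Finset.sum_eq_zero
    intro c _
    rw [if_neg, mul_zero]
    intro h
    apply hb
    have h2 := congrArg (· % q) h
    simp only [Nat.add_mul_mod_self_left] at h2
    rw [Nat.mod_eq_of_lt (by omega), Nat.mod_eq_of_lt (by omega)] at h2
    exact Fin.ext h2.symm
  · simp

open Polynomial in
theorem aux_coeff_zero {k : Type*} [Field k] (n q : ℕ) (hnq : n < q)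
    (A : Matrix (Fin (n + 1)) (Fin (n + 1)) k) (m : ℕ) (hm : n < m % q) :
    (∑ i : Fin (n + 1), ∑ j : Fin (n + 1),
      C (A i j) * X ^ ((i : ℕ) + q * (j : ℕ)) : k[X]).coeff m = 0 := by
  simp only [finsetSum_coeff, coeff_C_mul, coeff_X_pow]
  apply Finset.sum_eq_zero
  intro b _
  apply Finset.sum_eq_zero
  intro c _
  rw [if_neg, mul_zero]
  rintro rfl
  rw [Nat.add_mul_mod_self_left, Nat.mod_eq_of_lt (by omega)] at hm
  omega

open Polynomial in
theorem aux_low {k : Type*} [Field k] (n d : ℕ) (hn : (n : k) ≠ 0) (g : k[X])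
    (hg : g.coeff 0 ≠ 0) (hd : X ^ d ∣ g ^ n - C (g.coeff 0) ^ n) :
    X ^ d ∣ g - C (g.coeff 0) := by
  rw [← Commute.geom_sum₂_mul (Commute.all _ _)] at hd
  refine IsCoprime.dvd_of_dvd_mul_left ?_ hd
  apply IsCoprime.pow_left
  rw [← sub_zero X, ← C_0]
  refine (irreducible_X_sub_C (0:k)).coprime_iff_not_dvd.2 ?_
  rw [dvd_iff_isRoot, IsRoot.def, eval_finset_sum]
  simp only [eval_mul, eval_pow, eval_C, ← coeff_zero_eq_eval_zero]
  have : ∑ i ∈ Finset.range n, g.coeff 0 ^ i * g.coeff 0 ^ (n - 1 - i)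
      = n * g.coeff 0 ^ (n - 1) := by
    rw [Finset.sum_congr rfl (g := fun _ => g.coeff 0 ^ (n - 1))]
    · simp
    · intro i hi
      rw [← pow_add]
      congr 1
      have := Finset.mem_range.1 hi
      omega
  rw [this]
  exact mul_ne_zero hn (pow_ne_zero _ hg)

open Polynomial in
theorem aux_high {k : Type*} [Field k] (n q e : ℕ) (hn : (n : k) ≠ 0) (h : k[X])
    (hq : h.natDegree = q) (h0 : h ≠ 0) (he : e < q)
    (hd : (h ^ n - (C (h.coeff q) * X ^ q) ^ n).natDegree ≤ q * (n - 1) + e) :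
    (h - C (h.coeff q) * X ^ q).natDegree ≤ e := by
  have hc : h.coeff q ≠ 0 := by
    rw [← hq]; simpa using h0
  set r := C (h.coeff q) * X ^ q with hr
  have hrd : r.natDegree = q := natDegree_C_mul_X_pow _ _ hc
  rw [← Commute.geom_sum₂_mul (Commute.all _ _)] at hd
  set S := ∑ i ∈ Finset.range n, h ^ i * r ^ (n - 1 - i) with hS
  have hcoef : S.coeff (q * (n - 1)) = n * h.coeff q ^ (n - 1) := by
    rw [hS, finsetSum_coeff,
      Finset.sum_congr rfl (g := fun _ => h.coeff q ^ (n - 1))]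
    · simp
    · intro i hi
      have := Finset.mem_range.1 hi
      have e1 : q * (n - 1) = i * q + (n - 1 - i) * q := by
        rw [← add_mul, mul_comm]; congr 1; omega
      have hrc : r.coeff q = h.coeff q := by simp [hr]
      rw [e1, coeff_mul_add_eq_of_natDegree_le (natDegree_pow_le_of_le i hq.le)
        (natDegree_pow_le_of_le _ hrd.le),
        coeff_pow_of_natDegree_le hq.le, coeff_pow_of_natDegree_le hrd.le, hrc, ← pow_add]
      congr 1
      omega
  have hne : S.coeff (q * (n - 1)) ≠ 0 := by
    rw [hcoef]; exact mul_ne_zero hn (pow_ne_zero _ hc)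
  have hle := le_natDegree_of_ne_zero hne
  by_cases hz : h - r = 0
  · simp [hz]
  have hS0 : S ≠ 0 := by
    rintro h'; rw [h'] at hne; simp at hne
  rw [natDegree_mul hS0 hz] at hd
  omega

open Polynomial in
/-- Proposition 2.4: if `Σ aᵢⱼ t^{i+qj} = hⁿ` where `h` is separable of degree `q` with
`h(0) = h(1) = 0`, `p ∤ n` and `2n ≤ q`, then `h = b(t^q - t)` and `A = bⁿ B`. -/
theorem stmt_10 (p ν n q : ℕ) [Fact p.Prime] (hν : 0 < ν) (hq : q = p ^ ν)
    (k : Type*) [Field k] [IsAlgClosed k] [CharP k p] [Algebra (GaloisField p (2 * ν)) k]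
    (hn : 2 ≤ n) (hnp : ¬ p ∣ n) (h2n : 2 * n ≤ q)
    (A : Matrix (Fin (n + 1)) (Fin (n + 1)) k) (h : Polynomial k)
    (hdeg : h.natDegree = q) (hsep : h.Separable)
    (h0 : h.eval 0 = 0) (h1 : h.eval 1 = 0)
    (heq : (∑ i : Fin (n + 1), ∑ j : Fin (n + 1), C (A i j) * X ^ ((i : ℕ) + q * (j : ℕ)))
        = h ^ n) :
    ∃ b : k, b ≠ 0 ∧ h = C b * (X ^ q - X) ∧
      ∀ i j : Fin (n + 1), A i j =
        b ^ n * (if (i : ℕ) + (j : ℕ) = n then (-1 : k) ^ (i : ℕ) * (n.choose i : k) else 0) := by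
  have hnq : n < q := by omega
  have hnk : (n : k) ≠ 0 := by rwa [Ne, CharP.cast_eq_zero_iff k p]
  have hh0 : h ≠ 0 := by
    rintro rfl; simp at hdeg; omega
  have hcq : h.coeff q ≠ 0 := by
    rw [← hdeg]; simpa using hh0
  have hz : ∀ m, n < m % q → (h ^ n).coeff m = 0 := fun m hm => by
    rw [← heq]; exact aux_coeff_zero n q hnq A m hm
  -- low order part
  obtain ⟨g, hg⟩ : X ∣ h := by rw [X_dvd_iff, coeff_zero_eq_eval_zero, h0]
  have hg0 : g.coeff 0 ≠ 0 := by
    intro h'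
    obtain ⟨u, hu⟩ := X_dvd_iff.2 h'
    refine not_isUnit_X (hsep.squarefree X ⟨u, ?_⟩)
    rw [hg, hu, mul_assoc]
  have hlow : X ^ (q - n) ∣ g - C (g.coeff 0) := by
    apply aux_low n _ hnk g hg0
    rw [X_pow_dvd_iff]
    intro m hm
    rcases Nat.eq_zero_or_pos m with rfl | hm0
    · simp [coeff_zero_eq_eval_zero]
    · have := hz (m + n) (by rw [Nat.mod_eq_of_lt (by omega)]; omega)
      rw [hg, mul_pow, coeff_X_pow_mul] at this
      rw [coeff_sub, this, ← C_pow, coeff_C, if_neg (by omega), sub_zero]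
  have hlow' : ∀ m, 2 ≤ m → m ≤ q - n → h.coeff m = 0 := by
    intro m h2 hm
    obtain ⟨m, rfl⟩ : ∃ m', m = m' + 1 := ⟨m - 1, by omega⟩
    have := X_pow_dvd_iff.1 hlow m (by omega)
    rw [coeff_sub, coeff_C, if_neg (by omega), sub_zero] at this
    rw [hg, coeff_X_mul, this]
  -- high order part
  have hhigh : (h - C (h.coeff q) * X ^ q).natDegree ≤ n := by
    apply aux_high n q n hnk h hdeg hh0 hnq
    rw [natDegree_le_iff_coeff_eq_zero]
    intro m hm
    have e1 : q * n = q * (n - 1) + q := by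
      obtain ⟨n', rfl⟩ : ∃ n', n = n' + 1 := ⟨n - 1, by omega⟩
      simp [mul_add]
    have e2 : (C (h.coeff q) * X ^ q) ^ n = C (h.coeff q ^ n) * X ^ (q * n) := by
      rw [mul_pow, C_pow, pow_mul]
    rw [coeff_sub, e2, coeff_C_mul, coeff_X_pow]
    rcases lt_trichotomy m (q * n) with hlt | rfl | hgt
    · rw [if_neg (by omega), hz, mul_zero, sub_zero]
      obtain ⟨r, rfl⟩ : ∃ r, m = r + q * (n - 1) := ⟨m - q * (n - 1), by omega⟩
      rw [Nat.add_mul_mod_self_left, Nat.mod_eq_of_lt (by omega)]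
      omega
    · rw [if_pos rfl, mul_comm q n, coeff_pow_of_natDegree_le hdeg.le]; simp
    · rw [if_neg (by omega), mul_zero, sub_zero]
      apply coeff_eq_zero_of_natDegree_lt
      rw [natDegree_pow, hdeg, mul_comm]; exact hgt
  have hform : h = C (h.coeff q) * X ^ q + C (h.coeff 1) * X := by
    ext m
    rw [coeff_add, coeff_C_mul, coeff_X_pow, coeff_C_mul, coeff_X]
    by_cases hmq : m = q
    · subst hmq; simp; intro; omega
    rw [if_neg hmq]
    by_cases hm1 : m = 1
    · subst hm1; simp
    rw [if_neg (Ne.symm hm1)]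
    simp only [mul_zero, add_zero]
    rcases Nat.eq_zero_or_pos m with rfl | hm0
    · rw [coeff_zero_eq_eval_zero, h0]
    by_cases hmn : m ≤ n
    · exact hlow' m (by omega) (by omega)
    · have := natDegree_le_iff_coeff_eq_zero.1 hhigh m (by omega)
      simpa [coeff_X_pow, hmq] using this
  have hb1 : h.coeff 1 = - h.coeff q := by
    rw [hform] at h1
    simp only [eval_add, eval_mul, eval_C, eval_pow, eval_X, one_pow, mul_one] at h1
    exact (neg_eq_of_add_eq_zero_right h1).symm
  have hfin : h = C (h.coeff q) * (X ^ q - X) := by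
    conv_lhs => rw [hform, hb1]
    rw [C_neg]; ring
  refine ⟨h.coeff q, hcq, hfin, ?_⟩
  generalize h.coeff q = b at hfin
  let B : Matrix (Fin (n + 1)) (Fin (n + 1)) k := fun i j =>
    b ^ n * (if (i : ℕ) + (j : ℕ) = n then (-1 : k) ^ (i : ℕ) * (n.choose i : k) else 0)
  have hB : (∑ i : Fin (n + 1), ∑ j : Fin (n + 1), C (B i j) * X ^ ((i : ℕ) + q * (j : ℕ)))
      = h ^ n := by
    rw [hfin, mul_pow, sub_eq_neg_add, add_pow, Finset.mul_sum, Finset.sum_range]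
    apply Finset.sum_congr rfl
    intro i _
    rw [Finset.sum_eq_single (⟨n - i, by omega⟩ : Fin (n + 1))]
    · have : (i : ℕ) + (n - i) = n := by omega
      simp only [B, this, if_true]
      rw [neg_pow (X : k[X]), pow_add, pow_mul]
      simp only [C_mul, C_pow, C_neg, C_1, map_natCast]
      ring
    · intro j _ hj
      have : ¬ ((i : ℕ) + j = n) := by
        intro h'; apply hj; apply Fin.ext; simp; omega
      simp [B, this]
    · simp
  intro i j
  rw [← aux_coeff n q hnq A i j, heq, ← hB, aux_coeff n q hnq B i j]
end
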